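/- arXiv:2106.02499 — 2 statements merged into one kernel-verified Lean document; each statement's English description precedes it below -/
import Mathlib

section
/- Let A and B be finitely generated abelian groups. There exist finite symmetric generating sets S ⊆ A and T ⊆ B, with 0 ∉ S and 0 ∉ T, such that the Cayley graphs Cay(A,S) and Cay(B,T) are isomorphic as graphs, if and only if A and B have the same free rank and their torsion subgroups have the same (finite) order. -/
open Pointwise

/-- The Cayley graph of an abelian group `A` with respect to a symmetric subset `S`
not containing `0`: vertices are the elements of `A`, and `x`, `y` are adjacent
if and only if `x - y ∈ S`. -/
def addCayleyGraph {A : Type*} [AddCommGroup A] (S : Set A)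
    (hsym : -S = S) (h0 : (0 : A) ∉ S) : SimpleGraph A where
  Adj x y := x - y ∈ S
  symm := by
    constructor
    intro x y h
    have : -(x - y) ∈ -S := Set.neg_mem_neg.mpr h
    rw [hsym] at this
    simpa using this
  loopless := by
    constructor
    intro x h
    rw [sub_self] at h
    exact h0 h

/-- The free rank of an abelian group: the rank of its free part
in the decomposition `A ≅ ℤ^r ⊕ T` with `T` the torsion subgroup. -/
noncomputable def freeRank (A : Type*) [AddCommGroup A] : ℕ :=
  Module.finrank ℤ (A ⧸ AddCommGroup.torsion A)


namespace KrauseCayley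

section Rigid
variable {A : Type*} [AddCommGroup A]

local notation "τ" => AddCommGroup.torsion A

/-- Adjacency preserving permutations with bounded displacement. -/
def bddAut (S : Set A) : Subgroup (Equiv.Perm A) where
  carrier := {γ | (∀ x y, γ x - γ y ∈ S ↔ x - y ∈ S) ∧ ∃ F : Set A, F.Finite ∧ ∀ x, γ x - x ∈ F}
  mul_mem' := by
    rintro a b ⟨ha, F, hF, haF⟩ ⟨hb, F', hF', hbF⟩
    refine ⟨fun x y => ?_, F + F', hF.add hF', fun x => ?_⟩
    · simp [Equiv.Perm.mul_apply, ha, hb]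
    · refine ⟨a (b x) - b x, haF _, b x - x, hbF _, ?_⟩
      simp
  one_mem' := ⟨fun x y => by simp, {0}, Set.finite_singleton _, fun x => by simp⟩
  inv_mem' := by
    rintro a ⟨ha, F, hF, haF⟩
    refine ⟨fun x y => ?_, -F, hF.neg, fun x => ?_⟩
    · rw [← ha]; simp
    · have := haF (a⁻¹ x)
      rw [show a (a⁻¹ x) = x by simp] at this
      simpa using this

theorem addRight_mem (S : Set A) (b : A) : Equiv.addRight b ∈ bddAut S :=
  ⟨fun x y => by simp, {b}, Set.finite_singleton _, fun x => by simp⟩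

theorem map_torsion (f : A →+ ℤ) {a : A} (ha : a ∈ τ) : f a = 0 := by
  have h : IsOfFinAddOrder a := ha
  obtain ⟨n, hn, h⟩ := isOfFinAddOrder_iff_nsmul_eq_zero.1 h
  have := congrArg f h
  rw [map_nsmul, map_zero] at this
  simp at this
  omega

theorem rigid (hfin : Finite τ) (S : Set A) {γ : Equiv.Perm A} (hγ : γ ∈ bddAut S)
    (f : A →+ ℤ) (s : A) (hs : s ∈ S) (hmax : ∀ t ∈ S, f t ≤ f s)
    (heq : ∀ t ∈ S, f t = f s → t - s ∈ τ) (x : A) : γ (x + s) - γ x - s ∈ τ := by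
  obtain ⟨hadj, F, hF, hγF⟩ := hγ
  by_contra hx
  obtain ⟨x, hx, hmin⟩ : ∃ x, (γ (x + s) - γ x - s ∉ τ) ∧
      ∀ y, (γ (y + s) - γ y - s ∉ τ) → f (γ x - x) ≤ f (γ y - y) := by
    have hfinv : ((fun y => f (γ y - y)) '' {y | γ (y + s) - γ y - s ∉ τ}).Finite := by
      refine (hF.image f).subset ?_
      rintro _ ⟨y, -, rfl⟩
      exact ⟨_, hγF y, rfl⟩
    obtain ⟨_, ⟨x', hx', rfl⟩, h⟩ := Set.exists_min_image _ id hfinv ⟨_, x, hx, rfl⟩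
    exact ⟨x', hx', fun y hy => h _ ⟨y, hy, rfl⟩⟩
  have step : ∀ y, ∀ t ∈ S, f (γ (y + t)) ≤ f (γ y) + f s := by
    intro y t ht
    have := hmax (γ (y + t) - γ y) ((hadj _ _).2 (by simpa using ht))
    rw [map_sub] at this; linarith
  have hu0S : γ (x + s) - γ x ∈ S := (hadj _ _).2 (by simpa using hs)
  have hu0 : f (γ (x + s)) - f (γ x) < f s := by
    rw [← map_sub]
    exact lt_of_le_of_ne (hmax _ hu0S) fun h => hx (heq _ hu0S h)
  -- the points y n
  let y : ℕ → A := fun n => x + n • s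
  have hy0 : y 0 = x := by simp [y]
  have hysucc : ∀ n, y (n + 1) = y n + s := fun n => by simp [y, succ_nsmul, add_assoc]
  have hy1 : y 1 = x + s := by simp [y]
  have hmono : ∀ n, f (γ (y (n + 1))) ≤ f (γ (x + s)) + n * f s := by
    intro n
    induction n with
    | zero => simp [hy1]
    | succ n ih =>
      have := step (y (n + 1)) s hs
      rw [← hysucc] at this
      push_cast; linarith
  have hfy : ∀ n, f (y n) = f x + n * f s := fun n => by simp [y]
  have hu : ∀ n, γ (y (n + 2)) - γ (y (n + 1)) - s ∈ τ := by
    intro n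
    by_contra h
    rw [hysucc (n + 1)] at h
    have h1 := hmin _ h
    rw [map_sub, map_sub, hfy] at h1
    have := hmono n
    push_cast at h1
    linarith
  have hz : ∀ n, f (γ (y (n + 1))) = f (γ (x + s)) + n * f s := by
    intro n
    induction n with
    | zero => simp [hy1]
    | succ n ih =>
      have := map_torsion f (hu n)
      rw [map_sub, map_sub] at this
      push_cast; linarith
  let q : ℕ → A := fun k => γ x + (γ (y (k + 1)) - γ (y 1))
  let p : ℕ → A := fun k => γ.symm (q k)
  have hγp : ∀ k, γ (p k) = q k := fun k => by simp [p]
  have hp0 : p 0 = x := by simp [p, q]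
  have hpS : ∀ k, p (k + 1) - p k ∈ S := by
    intro k
    rw [← hadj, hγp, hγp]
    have : q (k + 1) - q k = γ (y (k + 2)) - γ (y (k + 1)) := by simp only [q]; abel
    rw [this, hadj, hysucc (k + 1)]
    simpa using hs
  have hpy : ∀ k, y (k + 1) - p k ∈ S := by
    intro k
    rw [← hadj, hγp]
    have : γ (y (k + 1)) - q k = γ (y 1) - γ x := by simp only [q]; abel
    rw [this, hy1]
    exact hu0S
  have hfp1 : ∀ k, f (p k) ≤ f x + k * f s := by
    intro k
    induction k with
    | zero => simp [hp0]
    | succ k ih =>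
      have := hmax _ (hpS k)
      rw [map_sub] at this
      push_cast; linarith
  have hfp : ∀ k, f (p k) = f x + k * f s := by
    intro k
    apply le_antisymm (hfp1 k)
    have := hmax _ (hpy k)
    rw [map_sub, hfy] at this
    push_cast at this
    linarith
  have hpτ : ∀ k, p k - y k ∈ τ := by
    intro k
    induction k with
    | zero => simp [hp0, hy0]
    | succ k ih =>
      have h1 : p (k + 1) - p k - s ∈ τ := by
        apply heq _ (hpS k)
        rw [map_sub, hfp, hfp]; push_cast; ring
      have := add_mem h1 ih
      rw [hysucc]
      convert this using 1
      abel
  obtain ⟨i, j, hne, hij⟩ := Finite.exists_ne_map_eq_of_infinite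
    (fun k : ℕ => (⟨p k - y k, hpτ k⟩ : τ))
  have key : ∀ i m : ℕ, p i - y i = p (i + (m + 1)) - y (i + (m + 1)) → False := by
    intro i m him
    have hw : ∀ k, f (γ (y (m + 1) + (p k - x))) ≤ f (γ (y (m + 1))) + k * f s := by
      intro k
      induction k with
      | zero => simp [hp0]
      | succ k ih =>
        have := step (y (m + 1) + (p k - x)) _ (hpS k)
        have e : y (m + 1) + (p k - x) + (p (k + 1) - p k) = y (m + 1) + (p (k + 1) - x) := by abel
        rw [e] at this
        push_cast; linarith
    have e : y (m + 1) + (p i - x) = p (i + (m + 1)) := by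
      have h2 : y (i + (m + 1)) = y i + y (m + 1) - x := by
        simp only [y, add_nsmul]; abel
      rw [h2] at him
      rw [eq_comm, sub_eq_iff_eq_add] at him
      rw [him]; abel
    have h1 := hw i
    rw [e, hγp, hz] at h1
    simp only [q, map_add, map_sub] at h1
    rw [hz, hy1] at h1
    push_cast at h1
    linarith
  have hij' : p i - y i = p j - y j := congrArg Subtype.val hij
  rcases lt_or_gt_of_ne hne with h | h
  · obtain ⟨m, rfl⟩ := Nat.exists_eq_add_of_lt h
    exact key i m (by simpa [add_assoc] using hij')
  · obtain ⟨m, rfl⟩ := Nat.exists_eq_add_of_lt h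
    exact key j m (by simpa [add_assoc] using hij'.symm)

theorem exists_hom_ne_zero (hA : AddGroup.FG A) {a : A} (ha : a ∉ τ) : ∃ f : A →+ ℤ, f a ≠ 0 := by
  have hV : AddGroup.FG (A ⧸ τ) := inferInstance
  have h1 : @Module.Finite ℤ (A ⧸ τ) _ _ (AddCommGroup.toIntModule _) :=
    Module.Finite.iff_addGroup_fg.2 hV
  let _ : Module ℤ (A ⧸ τ) := AddCommGroup.toIntModule _
  have h2 : Module.Free ℤ (A ⧸ τ) := inferInstance
  by_contra! h
  apply ha
  rw [← QuotientAddGroup.eq_zero_iff]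
  rw [← Module.forall_dual_apply_eq_zero_iff ℤ]
  intro g
  exact h (g.toAddMonoidHom.comp (QuotientAddGroup.mk' τ))

theorem exists_hom_forall_ne_zero (hA : AddGroup.FG A) {F : Set A} (hF : F.Finite)
    (h : ∀ a ∈ F, a ∉ τ) : ∃ f : A →+ ℤ, ∀ a ∈ F, f a ≠ 0 := by
  induction F, hF using Set.Finite.induction_on with
  | empty => exact ⟨0, by simp⟩
  | @insert a F haF hF ih =>
    obtain ⟨f, hf⟩ := ih fun b hb => h b (Set.mem_insert_of_mem _ hb)
    by_cases hfa : f a = 0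
    · obtain ⟨g, hg⟩ := exists_hom_ne_zero hA (h a (Set.mem_insert _ _))
      obtain ⟨N, hN⟩ := (hF.image fun b => |g b|).bddAbove
      have hN' : ∀ b ∈ F, |g b| ≤ N := fun b hb => hN ⟨b, hb, rfl⟩
      refine ⟨(|N| + 1) • f + g, ?_⟩
      intro b hb
      rcases hb with rfl | hb
      · simpa [hfa] using hg
      · intro h0
        simp only [AddMonoidHom.add_apply, AddMonoidHom.smul_apply, smul_eq_mul] at h0
        have h1 : |g b| = (|N| + 1) * |f b| := by
          rw [eq_neg_of_add_eq_zero_right h0, abs_neg, abs_mul, abs_of_pos (by positivity)]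
        have h2 := hN' b hb
        have h3 : 1 ≤ |f b| := Int.one_le_abs (hf b hb)
        have h4 := le_abs_self N
        nlinarith [abs_nonneg N]
    · exact ⟨f, fun b hb => by rcases hb with rfl | hb; exacts [hfa, hf b hb]⟩

theorem finite_torsion (hA : AddGroup.FG A) : Finite τ := by
  have h1 : Module.Finite ℤ A := Module.Finite.iff_addGroup_fg.2 hA
  have h2 : Module.Finite ℤ (AddSubgroup.toIntSubmodule τ) := inferInstance
  have h3 : AddGroup.FG τ := Module.Finite.iff_addGroup_fg.1 h2
  refine AddCommGroup.finite_of_fg_isAddTorsion _ ?_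
  intro x
  have := x.2
  have h : IsOfFinAddOrder (x : A) := this
  exact (AddSubmonoid.isOfFinAddOrder_coe (H := (τ).toAddSubmonoid)).1 h

/-- The group of common periods of all displacement functions modulo torsion. -/
def period (S : Set A) : AddSubgroup A where
  carrier := {a | ∀ γ ∈ bddAut S, ∀ x, γ (x + a) - γ x - a ∈ τ}
  zero_mem' := fun γ _ x => by simp
  add_mem' := by
    intro a b ha hb γ hγ x
    have := add_mem (ha γ hγ x) (hb γ hγ (x + a))
    convert this using 1
    rw [add_assoc]; abel
  neg_mem' := by
    intro a ha γ hγ x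
    have := neg_mem (ha γ hγ (x + -a))
    convert this using 1
    rw [neg_add_cancel_right]; abel

theorem finite_quotient_period (hA : AddGroup.FG A) (S : Set A) (hS : S.Finite) (hsym : -S = S)
    (hgen : AddSubgroup.closure S = ⊤) : Finite (A ⧸ period S) := by
  apply AddCommGroup.finite_of_fg_isAddTorsion
  by_contra hnt
  obtain ⟨v, hv⟩ : ∃ v : A ⧸ period S, v ∉ AddCommGroup.torsion (A ⧸ period S) := by
    by_contra! h
    exact hnt fun x => h x
  obtain ⟨f0, hf0⟩ := exists_hom_ne_zero (A := A ⧸ period S) inferInstance hv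
  let f1 : A →+ ℤ := f0.comp (QuotientAddGroup.mk' _)
  have hf1 : ∀ a ∈ period S, f1 a = 0 := by
    intro a ha
    simp [f1, (QuotientAddGroup.eq_zero_iff a).2 ha]
  obtain ⟨s1, hs1, hs1'⟩ : ∃ s ∈ S, 1 ≤ f1 s := by
    by_contra! h
    have h0 : ∀ s ∈ S, f1 s = 0 := by
      intro s hs
      have h1 := h s hs
      have h2 := h (-s) (by rw [← hsym]; simpa using hs)
      rw [map_neg] at h2
      omega
    have : f1 = 0 := AddMonoidHom.eq_of_eqOn_dense hgen (fun s hs => by simpa using h0 s hs)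
    obtain ⟨a, rfl⟩ := QuotientAddGroup.mk_surjective v
    exact hf0 (DFunLike.congr_fun this a)
  obtain ⟨f2, hf2⟩ := exists_hom_forall_ne_zero hA
    (F := {a ∈ S - S | a ∉ τ}) ((hS.sub hS).subset (Set.sep_subset _ _)) (fun a ha => ha.2)
  obtain ⟨N, hN⟩ := ((hS.sub hS).image fun b => |f2 b|).bddAbove
  have hN' : ∀ a ∈ S, ∀ b ∈ S, |f2 a - f2 b| ≤ N := fun a ha b hb => by
    rw [← map_sub]
    exact hN ⟨_, Set.sub_mem_sub ha hb, rfl⟩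
  let f : A →+ ℤ := (N + 1) • f1 + f2
  have hf : ∀ a, f a = (N + 1) * f1 a + f2 a := fun a => by simp [f]
  obtain ⟨s, hs, hmax⟩ := Set.exists_max_image S f hS ⟨s1, hs1⟩
  have hN0 : 0 ≤ N := le_trans (abs_nonneg _) (hN' s hs s hs)
  have hsp : s ∈ period S := by
    intro γ hγ x
    refine rigid (finite_torsion hA) S hγ f s hs hmax (fun t ht hts => ?_) x
    by_contra hτ
    have h2 := hf2 (t - s) ⟨Set.sub_mem_sub ht hs, hτ⟩
    rw [hf, hf] at hts
    have h3 := hN' t ht s hs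
    have h4 : f2 t - f2 s = (N + 1) * (f1 s - f1 t) := by linarith
    have h5 : f1 s - f1 t ≠ 0 := by
      intro h; rw [h, mul_zero, ← map_sub] at h4; exact h2 h4
    have h6 := Int.one_le_abs h5
    rw [h4, abs_mul, abs_of_pos (by linarith : 0 < N + 1)] at h3
    nlinarith
  have h1 := hf1 s hsp
  have h2 := hmax s1 hs1
  rw [hf, hf, h1] at h2
  have h3 := (abs_le.1 (hN' s hs s1 hs1)).2
  nlinarith

theorem sub_mem_period (S : Set A) {γ : Equiv.Perm A} (hγ : γ ∈ bddAut S) {x y : A}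
    (h : x - y ∈ period S) : γ x - γ y ∈ period S := by
  intro γ' hγ' w
  have h1 := h _ (mul_mem (mul_mem hγ' (addRight_mem S (w - γ y))) hγ) y
  have h2 := h γ hγ y
  have h3 := sub_mem h1 h2
  simp only [add_sub_cancel, Equiv.Perm.mul_apply, Equiv.coe_addRight] at h3
  convert h3 using 1
  rw [show γ x + (w - γ y) = w + (γ x - γ y) by abel]
  abel

/-- Displacement modulo torsion. -/
def disp (γ : Equiv.Perm A) (x : A) : A ⧸ τ := ((γ x - x : A) : A ⧸ τ)

theorem disp_eq (S : Set A) {γ : Equiv.Perm A} (hγ : γ ∈ bddAut S) {x y : A}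
    (h : x - y ∈ period S) : disp γ x = disp γ y := by
  have h2 := h γ hγ y
  unfold disp
  rw [← sub_eq_zero, ← QuotientAddGroup.mk_sub, QuotientAddGroup.eq_zero_iff]
  simp only [add_sub_cancel] at h2
  convert h2 using 1
  abel

/-- Total displacement. -/
noncomputable def total (S : Set A) (γ : Equiv.Perm A) : A ⧸ τ :=
  ∑ᶠ X : A ⧸ period S, disp γ X.out

theorem total_mul (S : Set A) (hfin : Finite (A ⧸ period S)) {γ γ' : Equiv.Perm A}
    (hγ : γ ∈ bddAut S) (hγ' : γ' ∈ bddAut S) :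
    total S (γ * γ') = total S γ + total S γ' := by
  have := Fintype.ofFinite (A ⧸ period S)
  have out_sub : ∀ a : A, a - ((a : A ⧸ period S)).out ∈ period S := by
    intro a
    rw [← QuotientAddGroup.eq_zero_iff]
    simp
  let σ : A ⧸ period S → A ⧸ period S := fun X => ((γ' X.out : A) : A ⧸ period S)
  have hσ : Function.Bijective σ := by
    rw [← Finite.injective_iff_bijective]
    intro X Y h
    have h1 : γ' X.out - γ' Y.out ∈ period S := by
      rw [← QuotientAddGroup.eq_zero_iff, QuotientAddGroup.mk_sub, sub_eq_zero]; exact h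
    have h2 := sub_mem_period S (inv_mem hγ') h1
    rw [show γ'⁻¹ (γ' X.out) = X.out by simp, show γ'⁻¹ (γ' Y.out) = Y.out by simp,
      ← QuotientAddGroup.eq_zero_iff, QuotientAddGroup.mk_sub, sub_eq_zero] at h2
    simpa using h2
  unfold total
  simp only [finsum_eq_sum_of_fintype]
  rw [← Function.Bijective.sum_comp hσ (fun X => disp γ X.out), ← Finset.sum_add_distrib]
  refine Finset.sum_congr rfl fun X _ => ?_
  have h1 : disp γ (σ X).out = disp γ (γ' X.out) := (disp_eq S hγ (out_sub _)).symm
  rw [h1]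
  simp only [disp, Equiv.Perm.mul_apply, ← QuotientAddGroup.mk_add]
  congr 1
  abel

theorem total_addRight (S : Set A) (b : A) :
    total S (Equiv.addRight b) = Nat.card (A ⧸ period S) • (b : A ⧸ τ) := by
  unfold total
  by_cases h : Finite (A ⧸ period S)
  · have := Fintype.ofFinite (A ⧸ period S)
    simp [disp, finsum_eq_sum_of_fintype]
  · have : Infinite (A ⧸ period S) := not_finite_iff_infinite.1 h
    rw [Nat.card_eq_zero_of_infinite, zero_smul]
    by_cases hb : (b : A ⧸ τ) = 0
    · simp [disp, hb]
    · apply finsum_of_infinite_support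
      have : (Function.support fun X : A ⧸ period S => disp (Equiv.addRight b) X.out) = Set.univ := by
        ext X; simpa [disp] using hb
      rw [this]; exact Set.infinite_univ

theorem total_one (S : Set A) : total S (1 : Equiv.Perm A) = 0 := by
  simp [total, disp]

theorem total_pow (S : Set A) (hfin : Finite (A ⧸ period S)) {γ : Equiv.Perm A}
    (hγ : γ ∈ bddAut S) (n : ℕ) : total S (γ ^ n) = n • total S γ := by
  induction n with
  | zero => simp [total_one]
  | succ n ih => rw [pow_succ, total_mul S hfin (pow_mem hγ n) hγ, ih, succ_nsmul]

/-- A generating set controls the displacement of differences, uniformly in the morphism. -/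
theorem exists_finite_diff {B : Type*} [AddCommGroup B] (S : Set A) (T : Set B) (hT : T.Finite)
    (hgen : AddSubgroup.closure S = ⊤) (a : A) :
    ∃ F : Set B, F.Finite ∧ ∀ γ : A → B, (∀ x y, x - y ∈ S → γ x - γ y ∈ T) →
      ∀ y, γ (y + a) - γ y ∈ F := by
  have ha : a ∈ AddSubgroup.closure S := by rw [hgen]; trivial
  induction ha using AddSubgroup.closure_induction with
  | mem s hs => exact ⟨T, hT, fun γ hγ y => hγ _ _ (by simpa using hs)⟩
  | zero => exact ⟨{0}, Set.finite_singleton _, fun γ _ y => by simp⟩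
  | add a b _ _ iha ihb =>
    obtain ⟨F, hF, h⟩ := iha
    obtain ⟨F', hF', h'⟩ := ihb
    refine ⟨F + F', hF.add hF', fun γ hγ y => ⟨_, h γ hγ y, _, h' γ hγ (y + a), ?_⟩⟩
    simp [add_assoc]
  | neg a _ iha =>
    obtain ⟨F, hF, h⟩ := iha
    refine ⟨-F, hF.neg, fun γ hγ y => ?_⟩
    have := h γ hγ (y + -a)
    simpa using this

theorem total_of_fix (S : Set A) (hS : S.Finite)
    (hgen : AddSubgroup.closure S = ⊤) (hfin : Finite (A ⧸ period S)) {γ : Equiv.Perm A}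
    (hγ : γ ∈ bddAut S) (h0 : γ 0 = 0) : total S γ = 0 := by
  have := Fintype.ofFinite (A ⧸ period S)
  choose F hF hdiff using exists_finite_diff S S hS hgen
  by_contra hne
  have hpow0 : ∀ n : ℕ, (γ ^ n) 0 = 0 := by
    intro n
    induction n with
    | zero => simp
    | succ n ih => rw [pow_succ, Equiv.Perm.mul_apply, h0, ih]
  have hinj : Function.Injective fun n : ℕ => total S (γ ^ n) := by
    simp only [total_pow S hfin hγ]
    exact injective_nsmul_iff_not_isOfFinAddOrder.2 (not_isOfFinAddOrder_of_isAddTorsionFree hne)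
  let P : Set (A ⧸ period S → A) := Set.univ.pi fun X => F X.out
  have hP : P.Finite := Set.Finite.pi fun X => hF (Quotient.out X)
  have hfr : (Set.range fun n : ℕ => total S (γ ^ n)).Finite := by
    refine (hP.image fun u => ∑ X, ((u X - X.out : A) : A ⧸ τ)).subset ?_
    rintro _ ⟨n, rfl⟩
    refine ⟨fun X => (γ ^ n) X.out, ?_, ?_⟩
    · intro X _
      have := hdiff X.out (⇑(γ ^ n)) (fun x y h => ((pow_mem hγ n).1 x y).2 h) 0
      simpa [hpow0] using this
    · simp [total, finsum_eq_sum_of_fintype, disp]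
  exact Set.infinite_range_of_injective hinj hfr

theorem sub_mem_torsion_of_total (S : Set A) (hS : S.Finite)
    (hgen : AddSubgroup.closure S = ⊤) (hfin : Finite (A ⧸ period S)) {γ : Equiv.Perm A}
    (hγ : γ ∈ bddAut S) (h0 : total S γ = 0) (y : A) : γ y - y ∈ τ := by
  have h1 : Equiv.addRight (-(γ y)) * (γ * Equiv.addRight y) ∈ bddAut S :=
    mul_mem (addRight_mem S _) (mul_mem hγ (addRight_mem S _))
  have h2 := total_of_fix S hS hgen hfin h1 (by simp [Equiv.Perm.mul_apply])
  rw [total_mul S hfin (addRight_mem S _) (mul_mem hγ (addRight_mem S _)),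
    total_mul S hfin hγ (addRight_mem S _), h0, total_addRight, total_addRight, zero_add,
    ← smul_add, ← QuotientAddGroup.mk_add] at h2
  have h3 : Nat.card (A ⧸ period S) ≠ 0 := Nat.card_pos.ne'
  have h4 := (smul_eq_zero_iff_right h3).1 h2
  rw [QuotientAddGroup.eq_zero_iff] at h4
  simpa [add_comm, sub_eq_add_neg] using neg_mem h4

end Rigid

section Forward
variable {A B : Type*} [AddCommGroup A] [AddCommGroup B]

theorem half (hA : AddGroup.FG A) (hB : AddGroup.FG B) (S : Set A) (T : Set B)
    (hS : S.Finite) (hT : T.Finite) (hTsym : -T = T)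
    (hSgen : AddSubgroup.closure S = ⊤) (hTgen : AddSubgroup.closure T = ⊤)
    (φ : A ≃ B) (hφ : ∀ x y, φ x - φ y ∈ T ↔ x - y ∈ S) :
    freeRank A ≤ freeRank B ∧
      Nat.card (AddCommGroup.torsion A) ≤ Nat.card (AddCommGroup.torsion B) := by
  have hfin := finite_quotient_period hB T hT hTsym hTgen
  have hτB := finite_torsion hB
  let c : A → Equiv.Perm B := fun a => (φ.symm.trans (Equiv.addRight a)).trans φ
  have hc : ∀ a b, c a b = φ (φ.symm b + a) := fun a b => rfl
  have hcm : ∀ a, c a ∈ bddAut T := by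
    intro a
    obtain ⟨F, hF, h⟩ := exists_finite_diff S T hT hSgen a
    refine ⟨fun x y => ?_, F, hF, fun x => ?_⟩
    · rw [hc, hc, hφ, add_sub_add_right_eq_sub, ← hφ]; simp
    · have := h φ (fun x y => (hφ x y).2) (φ.symm x)
      simpa [hc] using this
  have hcadd : ∀ a b, c (a + b) = c a * c b := by
    intro a b
    ext x
    simp only [hc, Equiv.Perm.mul_apply, Equiv.symm_apply_apply]
    congr 1; abel
  let Φ : A →+ B ⧸ AddCommGroup.torsion B := AddMonoidHom.mk' (fun a => total T (c a)) (by
    intro a b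
    rw [hcadd, total_mul T hfin (hcm a) (hcm b)])
  have h1 : ∀ a, Φ a = 0 → φ a - φ 0 ∈ AddCommGroup.torsion B := by
    intro a ha
    have := sub_mem_torsion_of_total T hT hTgen hfin (hcm a) ha (φ 0)
    simpa [hc] using this
  have h2 : ∀ a ∈ AddCommGroup.torsion A, Φ a = 0 := by
    intro a ha
    have h : IsOfFinAddOrder a := ha
    have h' : IsOfFinAddOrder (Φ a) := Φ.isOfFinAddOrder h
    by_contra hne
    exact not_isOfFinAddOrder_of_isAddTorsionFree hne h'
  have h3 : ∀ a, Φ a = 0 → a ∈ AddCommGroup.torsion A := by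
    intro a ha
    by_contra hna
    have hinj : Function.Injective fun n : ℕ => n • a :=
      injective_nsmul_iff_not_isOfFinAddOrder.2 hna
    let u : ℕ → AddCommGroup.torsion B := fun n => ⟨φ (n • a) - φ 0, h1 _ (by simp [ha])⟩
    have hu : Function.Injective u := by
      intro m n h
      have h' : φ (m • a) - φ 0 = φ (n • a) - φ 0 := congrArg Subtype.val h
      exact hinj (φ.injective (sub_left_injective h'))
    exact not_injective_infinite_finite u hu
  constructor
  · have hVB : Module.Finite ℤ (B ⧸ AddCommGroup.torsion B) :=
      Module.Finite.iff_addGroup_fg.2 inferInstance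
    let Ψ : (A ⧸ AddCommGroup.torsion A) →+ B ⧸ AddCommGroup.torsion B :=
      QuotientAddGroup.lift _ Φ h2
    have hΨ : Function.Injective Ψ := by
      rw [injective_iff_map_eq_zero]
      intro v hv
      obtain ⟨a, rfl⟩ := QuotientAddGroup.mk_surjective v
      exact (QuotientAddGroup.eq_zero_iff a).2 (h3 a hv)
    exact LinearMap.finrank_le_finrank_of_injective (f := AddMonoidHom.toIntLinearMap Ψ) hΨ
  · refine Nat.card_le_card_of_injective
      (fun a : AddCommGroup.torsion A =>
        (⟨φ a - φ 0, h1 _ (h2 a a.2)⟩ : AddCommGroup.torsion B)) ?_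
    intro a b h
    have h' : φ a - φ 0 = φ b - φ 0 := congrArg Subtype.val h
    exact Subtype.ext (φ.injective (sub_left_injective h'))

end Forward

section Backward

/-- The saturated connection set attached to a subset of the torsion-free quotient. -/
def sat {A : Type*} [AddCommGroup A] (W : Set (A ⧸ AddCommGroup.torsion A)) : Set A :=
  {a | a ≠ 0 ∧ (a : A ⧸ AddCommGroup.torsion A) ∈ W}

variable {A B : Type*} [AddCommGroup A] [AddCommGroup B]

theorem sat_finite (hA : AddGroup.FG A) (W : Set (A ⧸ AddCommGroup.torsion A)) (hW : W.Finite) :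
    (sat W).Finite := by
  have := finite_torsion hA
  have h1 : ((fun w : A ⧸ AddCommGroup.torsion A => w.out) '' W +
    (AddCommGroup.torsion A : Set A)).Finite := (hW.image _).add (Set.toFinite _)
  refine h1.subset ?_
  rintro a ⟨-, ha⟩
  refine ⟨_, ⟨_, ha, rfl⟩, a - (a : A ⧸ AddCommGroup.torsion A).out, ?_, by simp⟩
  rw [SetLike.mem_coe, ← QuotientAddGroup.eq_zero_iff]
  simp

theorem sat_neg (W : Set (A ⧸ AddCommGroup.torsion A)) (hW : -W = W) : -(sat W) = sat W := by
  ext a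
  have : (a : A ⧸ AddCommGroup.torsion A) ∈ W ↔ -(a : A ⧸ AddCommGroup.torsion A) ∈ W := by
    conv_lhs => rw [← hW]
    rfl
  simp [sat, this]

theorem sat_zero (W : Set (A ⧸ AddCommGroup.torsion A)) : (0 : A) ∉ sat W := fun h => h.1 rfl

theorem sat_closure (W : Set (A ⧸ AddCommGroup.torsion A)) (h0 : 0 ∈ W)
    (hW : AddSubgroup.closure W = ⊤) : AddSubgroup.closure (sat W) = ⊤ := by
  have hmem : ∀ a : A, (a : A ⧸ AddCommGroup.torsion A) ∈ W → a ∈ AddSubgroup.closure (sat W) := by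
    intro a ha
    by_cases h : a = 0
    · rw [h]; exact zero_mem _
    · exact AddSubgroup.subset_closure ⟨h, ha⟩
  have hmap : (AddSubgroup.closure (sat W)).map
      (QuotientAddGroup.mk' (AddCommGroup.torsion A)) = ⊤ := by
    rw [eq_top_iff, ← hW, AddSubgroup.closure_le]
    intro w hw
    obtain ⟨a, rfl⟩ := QuotientAddGroup.mk_surjective w
    exact ⟨a, hmem a hw, rfl⟩
  rw [eq_top_iff]
  intro a _
  have : (a : A ⧸ AddCommGroup.torsion A) ∈ (AddSubgroup.closure (sat W)).map
      (QuotientAddGroup.mk' (AddCommGroup.torsion A)) := by rw [hmap]; trivial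
  obtain ⟨b, hb, hba⟩ := this
  have h1 : ((a - b : A) : A ⧸ AddCommGroup.torsion A) = 0 := by
    rw [QuotientAddGroup.mk_sub, sub_eq_zero]; exact hba.symm
  have := add_mem (hmem (a - b) (by rw [h1]; exact h0)) hb
  simpa using this

/-- Splitting off the torsion part as sets. -/
noncomputable def split (A : Type*) [AddCommGroup A] :
    A ≃ (A ⧸ AddCommGroup.torsion A) × AddCommGroup.torsion A where
  toFun a := ((a : A ⧸ AddCommGroup.torsion A), ⟨a - (a : A ⧸ AddCommGroup.torsion A).out, by
    rw [← QuotientAddGroup.eq_zero_iff]; simp⟩)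
  invFun p := p.1.out + p.2
  left_inv a := by simp
  right_inv := by
    rintro ⟨v, t, ht⟩
    have h : ((v.out + t : A) : A ⧸ AddCommGroup.torsion A) = v := by
      rw [QuotientAddGroup.mk_add, (QuotientAddGroup.eq_zero_iff t).2 ht]; simp
    ext
    · exact h
    · simp only [h]; simp

theorem backward (hA : AddGroup.FG A) (hB : AddGroup.FG B) (hr : freeRank A = freeRank B)
    (hc : Nat.card (AddCommGroup.torsion A) = Nat.card (AddCommGroup.torsion B)) :
    ∃ (S : Set A) (T : Set B) (_ : S.Finite) (_ : T.Finite)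
        (hSsym : -S = S) (hTsym : -T = T) (hS0 : (0 : A) ∉ S) (hT0 : (0 : B) ∉ T),
        AddSubgroup.closure S = ⊤ ∧ AddSubgroup.closure T = ⊤ ∧
        Nonempty (addCayleyGraph S hSsym hS0 ≃g addCayleyGraph T hTsym hT0) := by
  have hτA := finite_torsion hA
  have hτB := finite_torsion hB
  obtain ⟨e⟩ : Nonempty ((A ⧸ AddCommGroup.torsion A) ≃+ (B ⧸ AddCommGroup.torsion B)) := by
    have h1 : Module.Finite ℤ (A ⧸ AddCommGroup.torsion A) :=
      Module.Finite.iff_addGroup_fg.2 inferInstance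
    have h2 : Module.Finite ℤ (B ⧸ AddCommGroup.torsion B) :=
      Module.Finite.iff_addGroup_fg.2 inferInstance
    exact ⟨(LinearEquiv.ofFinrankEq (R := ℤ) _ _ hr).toAddEquiv⟩
  obtain ⟨t⟩ : Nonempty (AddCommGroup.torsion A ≃ AddCommGroup.torsion B) :=
    Finite.card_eq.1 hc
  obtain ⟨W, hWf, hW0, hWn, hWc⟩ : ∃ W : Set (A ⧸ AddCommGroup.torsion A), W.Finite ∧ 0 ∈ W ∧
      -W = W ∧ AddSubgroup.closure W = ⊤ := by
    have : AddGroup.FG (A ⧸ AddCommGroup.torsion A) := inferInstance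
    obtain ⟨G, hG, hGf⟩ := AddGroup.fg_iff.1 this
    refine ⟨{0} ∪ (G ∪ -G), (Set.finite_singleton _).union (hGf.union hGf.neg), by simp, ?_, ?_⟩
    · simp [Set.union_neg, Set.union_comm]
    · rw [eq_top_iff, ← hG]
      exact AddSubgroup.closure_mono fun x hx => Or.inr (Or.inl hx)
  have hW'0 : 0 ∈ e '' W := ⟨0, hW0, map_zero e⟩
  have hW'n : -(e '' W) = e '' W := by
    conv_rhs => rw [← hWn]
    exact (Set.image_neg e W).symm
  have hW'c : AddSubgroup.closure (e '' W) = ⊤ := by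
    have := AddMonoidHom.map_closure e.toAddMonoidHom W
    rw [hWc, AddSubgroup.map_top_of_surjective _ e.surjective] at this
    exact this.symm
  let φ : A ≃ B := ((split A).trans (e.toEquiv.prodCongr t)).trans (split B).symm
  have hφ : ∀ a, ((φ a : B) : B ⧸ AddCommGroup.torsion B) = e (a : A ⧸ AddCommGroup.torsion A) := by
    intro a
    have h : split B (φ a) = (e.toEquiv.prodCongr t) (split A a) := by simp [φ]
    exact congrArg Prod.fst h
  refine ⟨sat W, sat (e '' W), sat_finite hA W hWf, sat_finite hB _ (hWf.image e), sat_neg W hWn,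
    sat_neg _ hW'n, sat_zero W, sat_zero _, sat_closure W hW0 hWc, sat_closure _ hW'0 hW'c,
    ⟨⟨φ, ?_⟩⟩⟩
  intro x y
  change φ x - φ y ∈ sat (e '' W) ↔ x - y ∈ sat W
  simp only [sat, Set.mem_ofPred_eq, sub_ne_zero, ne_eq, φ.injective.eq_iff,
    QuotientAddGroup.mk_sub, hφ, ← map_sub, e.injective.mem_set_image]

end Backward

end KrauseCayley

/-- Krause (1953), Satz 16.1: two finitely generated abelian groups admit finite symmetric
generating sets (avoiding `0`) with isomorphic Cayley graphs if and only if they have the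
same free rank and their torsion subgroups have the same order. -/
theorem krause_cayley_graphs {A B : Type*} [AddCommGroup A] [AddCommGroup B]
    (hA : AddGroup.FG A) (hB : AddGroup.FG B) :
    (∃ (S : Set A) (T : Set B) (_ : S.Finite) (_ : T.Finite)
        (hSsym : -S = S) (hTsym : -T = T) (hS0 : (0 : A) ∉ S) (hT0 : (0 : B) ∉ T),
        AddSubgroup.closure S = ⊤ ∧ AddSubgroup.closure T = ⊤ ∧
        Nonempty (addCayleyGraph S hSsym hS0 ≃g addCayleyGraph T hTsym hT0)) ↔
      (freeRank A = freeRank B ∧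
        Nat.card (AddCommGroup.torsion A) = Nat.card (AddCommGroup.torsion B)) := by
  constructor
  · rintro ⟨S, T, hS, hT, hSsym, hTsym, hS0, hT0, hSgen, hTgen, ⟨φ⟩⟩
    have hφ : ∀ x y, φ x - φ y ∈ T ↔ x - y ∈ S := fun x y => φ.map_rel_iff
    have h1 := KrauseCayley.half hA hB S T hS hT hTsym hSgen hTgen φ.toEquiv hφ
    have h2 := KrauseCayley.half hB hA T S hT hS hSsym hTgen hSgen φ.toEquiv.symm (by
      intro x y
      have := hφ (φ.toEquiv.symm x) (φ.toEquiv.symm y)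
      rw [show φ (φ.toEquiv.symm x) = x from φ.toEquiv.apply_symm_apply x,
        show φ (φ.toEquiv.symm y) = y from φ.toEquiv.apply_symm_apply y] at this
      exact this.symm)
    exact ⟨le_antisymm h1.1 h2.1, le_antisymm h1.2 h2.2⟩
  · rintro ⟨hr, hc⟩
    exact KrauseCayley.backward hA hB hr hc
end

section
/- Let n ≥ 1, let V = {x ∈ ℝ^{n+1} : x₁ + ⋯ + x_{n+1} = 0}, let Γ = ℤ^{n+1} ∩ V, and let P ⊆ V be the convex hull of the vectors ±(e_i − e_j) for 1 ≤ i < j ≤ n+1. For k ≥ 0 let E(k) = |Γ ∩ kP|. Then, as an identity of formal power series (equivalently, for all complex z with |z| < 1), ∑_{k=0}^∞ E(k) z^k = (∑_{j=0}^n binom(n,j)² z^j) / (1−z)^{n+1}. -/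
open Pointwise

lemma an_coeff_X_mul_deriv (f : ℕ → ℤ) (k : ℕ) :
    PowerSeries.coeff k (PowerSeries.X * PowerSeries.derivative ℤ (PowerSeries.mk f)) = k * f k := by
  cases k with
  | zero => simp
  | succ k =>
    rw [PowerSeries.coeff_succ_X_mul, PowerSeries.coeff_derivative, PowerSeries.coeff_mk]
    push_cast; ring

lemma an_choose_rec (m n i : ℕ) :
    ((i + 1 : ℕ) : ℤ) * ((m.choose (i+1) : ℤ) * n.choose (i+1)) - i * ((m.choose i : ℤ) * n.choose i)
      + (m + n + 1) * ((m.choose i : ℤ) * n.choose i)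
      + (m + 1) * ((m.choose (i+1) : ℤ) * n.choose (i+1) - (m.choose i : ℤ) * n.choose i)
      = (m + 1) * (((m+1).choose (i+1) : ℤ) * n.choose (i+1)) := by
  have h1 : (n.choose (i+1) : ℤ) * (i + 1) = n.choose i * (n - i) := by
    rcases le_or_gt i n with h | h
    · have := Nat.choose_succ_right_eq n i
      zify [h] at this
      exact this
    · rw [Nat.choose_eq_zero_of_lt h, Nat.choose_eq_zero_of_lt (by omega)]; simp
  have h2 : ((m+1).choose (i+1) : ℤ) = m.choose i + m.choose (i+1) := by
    rw [Nat.choose_succ_succ]; push_cast; ring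
  have h3 : (m.choose (i+1) : ℤ) * (i + 1) = m.choose i * (m - i) := by
    rcases le_or_gt i m with h | h
    · have := Nat.choose_succ_right_eq m i
      zify [h] at this
      exact this
    · rw [Nat.choose_eq_zero_of_lt h, Nat.choose_eq_zero_of_lt (by omega)]; simp
  rw [h2]
  push_cast
  linear_combination (-(m.choose i : ℤ)) * h1 + (n.choose (i+1) : ℤ) * h3

lemma an_li (n m : ℕ) :
    PowerSeries.mk (fun k : ℕ => ((m + k).choose m : ℤ) * ((n + k).choose n : ℤ)) *
      (1 - PowerSeries.X) ^ (m + n + 1)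
    = PowerSeries.mk (fun j : ℕ => (m.choose j : ℤ) * (n.choose j : ℤ)) := by
  induction m with
  | zero =>
    have := PowerSeries.mk_add_choose_mul_one_sub_pow_eq_one ℤ n
    simp only [Nat.choose_zero_right, Nat.cast_one, one_mul, zero_add]
    rw [this]
    ext j
    cases j <;> simp [PowerSeries.coeff_one]
  | succ m ih =>
    set F := PowerSeries.mk (fun k : ℕ => ((m + k).choose m : ℤ) * ((n + k).choose n : ℤ)) with hF
    set A := PowerSeries.mk (fun j : ℕ => (m.choose j : ℤ) * (n.choose j : ℤ)) with hA
    have hD := congrArg (PowerSeries.derivative ℤ) ih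
    rw [Derivation.leibniz, PowerSeries.derivative_pow, map_sub, PowerSeries.derivative_one,
      PowerSeries.derivative_X] at hD
    simp only [smul_eq_mul, add_tsub_cancel_right] at hD
    have h1 : ((m + 1 : ℤ) : PowerSeries ℤ) * PowerSeries.mk (fun k : ℕ => ((m + 1 + k).choose (m+1) : ℤ) * ((n + k).choose n : ℤ))
        = PowerSeries.X * PowerSeries.derivative ℤ F + ((m + 1 : ℤ) : PowerSeries ℤ) * F := by
      ext k
      rw [map_add, hF, an_coeff_X_mul_deriv, ← map_intCast (PowerSeries.C (R := ℤ)), PowerSeries.coeff_C_mul,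
        PowerSeries.coeff_C_mul, PowerSeries.coeff_mk, PowerSeries.coeff_mk]
      have := Nat.add_one_mul_choose_eq (m + k) m
      rw [show m + k + 1 = m + 1 + k by ring] at this
      zify at this
      simp only [Int.cast_id]
      linear_combination (-((n + k).choose n : ℤ)) * this
    have h2 : ((m + 1 : ℤ) : PowerSeries ℤ) * PowerSeries.mk (fun j : ℕ => ((m+1).choose j : ℤ) * (n.choose j : ℤ))
        = PowerSeries.X * PowerSeries.derivative ℤ A - PowerSeries.X * (PowerSeries.X * PowerSeries.derivative ℤ A)
         + ((m + n + 1 : ℤ) : PowerSeries ℤ) * (PowerSeries.X * A) + ((m + 1 : ℤ) : PowerSeries ℤ) * (A - PowerSeries.X * A) := by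
      ext k
      simp only [map_add, map_sub, ← map_intCast (PowerSeries.C (R := ℤ)), PowerSeries.coeff_C_mul]
      rw [hA, an_coeff_X_mul_deriv]
      cases k with
      | zero => simp
      | succ i =>
        simp only [PowerSeries.coeff_succ_X_mul, an_coeff_X_mul_deriv, PowerSeries.coeff_mk]
        have := an_choose_rec m n i
        simp only [Int.cast_id]
        linarith
    have hne : ((m + 1 : ℤ) : PowerSeries ℤ) ≠ 0 := by
      rw [← map_intCast (PowerSeries.C (R := ℤ))]
      intro h
      have := congrArg (PowerSeries.coeff 0) h
      simp at this
      omega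
    apply mul_left_cancel₀ hne
    rw [h2, ← mul_assoc, h1, show m + 1 + n + 1 = (m + n + 1) + 1 by ring, ← hD, ← ih]
    push_cast
    ring

lemma an_card (n k : ℕ) :
    (Finset.piAntidiag (Finset.univ : Finset (Fin (n+1))) k).card = (n + k).choose n := by
  have : (Finset.piAntidiag (Finset.univ : Finset (Fin (n+1))) k).card =
      (Finset.finsuppAntidiag (Finset.univ : Finset (Fin (n+1))) k).card := by
    rw [Finset.finsuppAntidiag]
    simp
  rw [this, Finset.card_finsuppAntidiag_nat_eq_choose]
  simp only [Finset.card_univ, Fintype.card_fin]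
  rw [show n + 1 + k - 1 = n + k by omega, Nat.choose_symm_add]

/-- Pairs of disjointly supported vectors of size `m`. -/
def anT (n m : ℕ) : Finset ((Fin (n+1) → ℕ) × (Fin (n+1) → ℕ)) :=
  (Finset.piAntidiag Finset.univ m ×ˢ Finset.piAntidiag Finset.univ m).filter
    (fun p => ∀ i, p.1 i = 0 ∨ p.2 i = 0)

lemma mem_anT {n m : ℕ} {p : (Fin (n+1) → ℕ) × (Fin (n+1) → ℕ)} :
    p ∈ anT n m ↔ (∑ i, p.1 i = m ∧ ∑ i, p.2 i = m) ∧ ∀ i, p.1 i = 0 ∨ p.2 i = 0 := by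
  simp [anT]

lemma an_pairs (n k : ℕ) :
    ((n + k).choose n) ^ 2 = ∑ p ∈ Finset.HasAntidiagonal.antidiagonal k, (anT n p.1).card * (n + p.2).choose n := by
  have : ((Finset.piAntidiag (Finset.univ : Finset (Fin (n+1))) k) ×ˢ
      (Finset.piAntidiag (Finset.univ : Finset (Fin (n+1))) k)).card =
      ((Finset.HasAntidiagonal.antidiagonal k).sigma (fun p => anT n p.1 ×ˢ
        Finset.piAntidiag (Finset.univ : Finset (Fin (n+1))) p.2)).card := by
    symm
    refine Finset.card_nbij' (fun q => (q.2.1.1 + q.2.2, q.2.1.2 + q.2.2))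
      (fun q => ⟨(∑ i, (q.1 i - min (q.1 i) (q.2 i)), ∑ i, min (q.1 i) (q.2 i)),
        ((fun i => q.1 i - min (q.1 i) (q.2 i), fun i => q.2 i - min (q.1 i) (q.2 i)),
          fun i => min (q.1 i) (q.2 i))⟩) ?_ ?_ ?_ ?_
    · rintro ⟨⟨a, b⟩, ⟨u, v⟩, w⟩ h
      simp [mem_anT, Finset.sum_add_distrib] at h ⊢
      obtain ⟨hab, ⟨⟨h1, h2⟩, h3⟩, h4⟩ := h
      subst h4
      constructor
      · rw [h1, ← hab]
      · rw [h2, ← hab]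
    · rintro ⟨u, v⟩ h
      simp at h
      have e1 : ∑ i, (u i - min (u i) (v i)) + ∑ i, min (u i) (v i) = k := by
        rw [← Finset.sum_add_distrib, ← h.1]
        exact Finset.sum_congr rfl (fun i _ => by omega)
      have e2 : ∑ i, (v i - min (u i) (v i)) + ∑ i, min (u i) (v i) = k := by
        rw [← Finset.sum_add_distrib, ← h.2]
        exact Finset.sum_congr rfl (fun i _ => by omega)
      simp only [Finset.coe_sigma, Set.mem_sigma_iff, Finset.mem_coe, Finset.HasAntidiagonal.mem_antidiagonal,
        Finset.mem_product, mem_anT, Finset.mem_piAntidiag]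
      refine ⟨e1, ⟨⟨trivial, by omega⟩, fun i => by omega⟩, trivial, by simp⟩
    · rintro ⟨⟨a, b⟩, ⟨u, v⟩, w⟩ h
      simp only [Finset.coe_sigma, Set.mem_sigma_iff, Finset.mem_coe, Finset.HasAntidiagonal.mem_antidiagonal,
        Finset.mem_product, mem_anT, Finset.mem_piAntidiag] at h
      obtain ⟨hab, ⟨⟨h1, h2⟩, h3⟩, h4, -⟩ := h
      have hm : ∀ i, min (u i + w i) (v i + w i) = w i := fun i => by
        have := h3 i; omega
      simp only [Pi.add_apply, hm, Nat.add_sub_cancel]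
      subst h1 h4
      rfl
    · rintro ⟨u, v⟩ h
      ext i <;> simp
  rw [Finset.card_product, an_card, Finset.card_sigma] at this
  rw [sq, this]
  exact Finset.sum_congr rfl (fun p _ => by rw [Finset.card_product, an_card])

/-- The roots of type `A_n`. -/
def anRoots (n : ℕ) : Set (Fin (n+1) → ℝ) :=
  {v : Fin (n + 1) → ℝ | ∃ i j : Fin (n + 1), i < j ∧
                (v = Pi.single i (1 : ℝ) - Pi.single j (1 : ℝ) ∨
                 v = Pi.single j (1 : ℝ) - Pi.single i (1 : ℝ))}

lemma an_root_mem {n : ℕ} {i j : Fin (n+1)} (h : i ≠ j) :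
    (Pi.single i (1 : ℝ) - Pi.single j (1 : ℝ) : Fin (n+1) → ℝ) ∈ anRoots n := by
  rcases lt_or_gt_of_ne h with h | h
  · exact ⟨i, j, h, Or.inl rfl⟩
  · exact ⟨j, i, h, Or.inr rfl⟩

lemma an_hull_le {n : ℕ} {y : Fin (n+1) → ℝ} (hy : y ∈ convexHull ℝ (anRoots n)) :
    ∑ i, |y i| ≤ 2 := by
  have hc : Convex ℝ {y : Fin (n+1) → ℝ | ∑ i, |y i| ≤ 2} := by
    intro x hx y hy a b ha hb hab
    simp only [Set.mem_ofPred_eq] at *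
    calc ∑ i, |(a • x + b • y) i| ≤ ∑ i, (a * |x i| + b * |y i|) := by
          refine Finset.sum_le_sum (fun i _ => ?_)
          simp only [Pi.add_apply, Pi.smul_apply, smul_eq_mul]
          refine (abs_add_le _ _).trans ?_
          rw [abs_mul, abs_mul, abs_of_nonneg ha, abs_of_nonneg hb]
      _ = a * ∑ i, |x i| + b * ∑ i, |y i| := by
          rw [Finset.sum_add_distrib, Finset.mul_sum, Finset.mul_sum]
      _ ≤ a * 2 + b * 2 := by gcongr
      _ = 2 := by rw [← add_mul, hab, one_mul]
  have key : ∀ i j : Fin (n+1),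
      ∑ l, |(Pi.single i (1 : ℝ) - Pi.single j (1 : ℝ) : Fin (n+1) → ℝ) l| ≤ 2 := by
    intro i j
    calc ∑ l, |(Pi.single i (1 : ℝ) - Pi.single j (1 : ℝ) : Fin (n+1) → ℝ) l|
        ≤ ∑ l, ((Pi.single i (1 : ℝ) : Fin (n+1) → ℝ) l + (Pi.single j (1 : ℝ) : Fin (n+1) → ℝ) l) := by
          refine Finset.sum_le_sum (fun l _ => ?_)
          simp only [Pi.sub_apply, Pi.single_apply]
          split_ifs <;> norm_num
      _ = 2 := by
          rw [Finset.sum_add_distrib]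
          simp [Finset.sum_pi_single']
          norm_num
  refine convexHull_min ?_ hc hy
  rintro v ⟨i, j, -, rfl | rfl⟩
  · exact key i j
  · exact key j i

lemma an_mem_smul {n : ℕ} (hn : 1 ≤ n) (k : ℕ) : ∀ m ≤ k, ∀ u v : Fin (n+1) → ℕ,
    ∑ i, u i = m → ∑ i, v i = m → (∀ i, u i = 0 ∨ v i = 0) →
    (fun i => (u i : ℝ) - v i) ∈ (k : ℝ) • convexHull ℝ (anRoots n) := by
  have hconv := convex_convexHull ℝ (anRoots n)
  have h01 : (0 : Fin (n+1)) ≠ Fin.last n := by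
    intro h
    have := congrArg Fin.val h
    simp at this
    omega
  have h0 : (0 : Fin (n+1) → ℝ) ∈ convexHull ℝ (anRoots n) := by
    have ha := subset_convexHull ℝ _ (an_root_mem h01)
    have hb := subset_convexHull ℝ _ (an_root_mem h01.symm)
    have := hconv ha hb (a := 1/2) (b := 1/2) (by norm_num) (by norm_num) (by norm_num)
    convert this using 1
    ext i
    simp
    ring
  induction k with
  | zero =>
    intro m hm u v hu hv _
    obtain rfl : m = 0 := by omega
    simp only [Finset.sum_eq_zero_iff, Finset.mem_univ, true_imp_iff] at hu hv
    refine ⟨0, h0, ?_⟩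
    ext i
    simp [hu, hv]
  | succ k ih =>
    intro m hm u v hu hv huv
    push_cast
    rw [hconv.add_smul (by positivity) zero_le_one, one_smul]
    rcases m with _ | m
    · simp only [Finset.sum_eq_zero_iff, Finset.mem_univ, true_imp_iff] at hu hv
      refine ⟨0, ⟨0, h0, by simp⟩, 0, h0, ?_⟩
      ext i
      simp [hu, hv]
    · obtain ⟨i, -, hi⟩ : ∃ i ∈ Finset.univ, u i ≠ 0 :=
        Finset.exists_ne_zero_of_sum_ne_zero (by omega)
      obtain ⟨j, -, hj⟩ : ∃ i ∈ Finset.univ, v i ≠ 0 :=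
        Finset.exists_ne_zero_of_sum_ne_zero (by omega)
      have hij : i ≠ j := by
        rintro rfl
        have := huv i
        omega
      have hsum : ∀ (w : Fin (n+1) → ℕ) (i : Fin (n+1)), w i ≠ 0 → ∑ l, w l = m + 1 →
          ∑ l, (w l - (Pi.single i 1 : Fin (n+1) → ℕ) l) = m := by
        intro w i hi hw
        have : ∑ l, (w l - (Pi.single i 1 : Fin (n+1) → ℕ) l)
            + ∑ l, (Pi.single i 1 : Fin (n+1) → ℕ) l = ∑ l, w l := by
          rw [← Finset.sum_add_distrib]
          refine Finset.sum_congr rfl (fun l _ => Nat.sub_add_cancel ?_)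
          rw [Pi.single_apply]
          split_ifs with h
          · subst h; omega
          · omega
        rw [Finset.sum_pi_single', if_pos (Finset.mem_univ _)] at this
        omega
      have := ih m (by omega) (fun l => u l - (Pi.single i 1 : Fin (n+1) → ℕ) l)
        (fun l => v l - (Pi.single j 1 : Fin (n+1) → ℕ) l) (hsum u i hi hu) (hsum v j hj hv)
        (fun l => by have := huv l; omega)
      refine ⟨_, this, _, subset_convexHull ℝ _ (an_root_mem hij), ?_⟩
      have hcast : ∀ (w : Fin (n+1) → ℕ) (i : Fin (n+1)), w i ≠ 0 → ∀ l,
          ((w l - (Pi.single i 1 : Fin (n+1) → ℕ) l : ℕ) : ℝ) =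
            w l - (Pi.single i (1 : ℝ) : Fin (n+1) → ℝ) l := by
        intro w i hi l
        rw [Pi.single_apply, Pi.single_apply]
        split_ifs with h
        · subst h; rw [Nat.cast_sub (by omega)]; simp
        · simp
      ext l
      simp only [Pi.add_apply, Pi.sub_apply, hcast u i hi, hcast v j hj]
      ring

lemma an_set_eq {n : ℕ} (hn : 1 ≤ n) (k : ℕ) :
    {x : Fin (n + 1) → ℤ | (∑ i, x i) = 0 ∧
            (fun i => (x i : ℝ)) ∈ (k : ℝ) • convexHull ℝ (anRoots n)} =
    (((Finset.range (k+1)).biUnion (anT n)).image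
      (fun p => fun i => (p.1 i : ℤ) - (p.2 i : ℤ)) : Finset (Fin (n+1) → ℤ)) := by
  ext x
  simp only [Set.mem_ofPred_eq, Finset.coe_image, Set.mem_image, Finset.mem_coe,
    Finset.mem_biUnion, Finset.mem_range, mem_anT]
  constructor
  · rintro ⟨hx, y, hy, hyx⟩
    have hle := an_hull_le hy
    have hpos : ∑ i, (((x i).toNat : ℤ) - ((-x i).toNat : ℤ)) = 0 := by
      rw [← hx]
      exact Finset.sum_congr rfl (fun i _ => by omega)
    rw [Finset.sum_sub_distrib] at hpos
    have habs : ∑ i, |x i| ≤ 2 * k := by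
      have : ∑ i, |(x i : ℝ)| = k * ∑ i, |y i| := by
        rw [Finset.mul_sum]
        refine Finset.sum_congr rfl (fun i _ => ?_)
        have := congrFun hyx i
        simp only [Pi.smul_apply, smul_eq_mul] at this
        rw [← this, abs_mul, Nat.abs_cast]
      have h2 : ∑ i, |(x i : ℝ)| ≤ 2 * k := by
        rw [this, mul_comm]
        gcongr
      exact_mod_cast h2
    have habs' : ∑ i, |x i| = ∑ i, ((x i).toNat : ℤ) + ∑ i, ((-x i).toNat : ℤ) := by
      rw [← Finset.sum_add_distrib]
      exact Finset.sum_congr rfl (fun i _ => by rw [abs_eq_max_neg]; omega)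
    have c1 : ((∑ i, (x i).toNat : ℕ) : ℤ) = ∑ i, ((x i).toNat : ℤ) := by push_cast; rfl
    have c2 : ((∑ i, (-x i).toNat : ℕ) : ℤ) = ∑ i, ((-x i).toNat : ℤ) := by push_cast; rfl
    refine ⟨(fun i => (x i).toNat, fun i => (-x i).toNat), ⟨∑ i, (x i).toNat, ?_, ⟨rfl, ?_⟩, ?_⟩, ?_⟩
    · omega
    · simp only; omega
    · intro i; simp only; omega
    · ext i; simp only; omega
  · rintro ⟨⟨u, v⟩, ⟨m, hm, ⟨hu, hv⟩, huv⟩, rfl⟩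
    simp only at hu hv huv ⊢
    refine ⟨?_, ?_⟩
    · rw [Finset.sum_sub_distrib, ← Nat.cast_sum, ← Nat.cast_sum, hu, hv, sub_self]
    · have := an_mem_smul hn k m (by omega) u v hu hv huv
      simpa using this

lemma an_ncard {n : ℕ} (hn : 1 ≤ n) (k : ℕ) :
    {x : Fin (n + 1) → ℤ | (∑ i, x i) = 0 ∧
            (fun i => (x i : ℝ)) ∈ (k : ℝ) • convexHull ℝ (anRoots n)}.ncard =
    ∑ m ∈ Finset.range (k+1), (anT n m).card := by
  rw [an_set_eq hn, Set.ncard_coe_finset, Finset.card_image_of_injOn, Finset.card_biUnion]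
  · intro a _ b _ hab
    rw [Function.onFun, Finset.disjoint_left]
    intro p hp hq
    rw [mem_anT] at hp hq
    exact hab (hp.1.1.symm.trans hq.1.1)
  · rintro ⟨u, v⟩ hp ⟨u', v'⟩ hq h
    simp only [Finset.coe_biUnion, Set.mem_iUnion, Finset.mem_coe, mem_anT] at hp hq
    obtain ⟨_, _, _, hp⟩ := hp
    obtain ⟨_, _, _, hq⟩ := hq
    have : ∀ i, u i = u' i ∧ v i = v' i := by
      intro i
      have h1 := congrFun h i
      have h2 := hp i
      have h3 := hq i
      simp only at h1 h2 h3
      omega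
    ext i
    · exact (this i).1
    · exact (this i).2



/-- Ehrhart series of the root polytope of type `A_n`: with
`Γ = ℤ^{n+1} ∩ {x : ∑ xᵢ = 0}` and `P = conv{±(eᵢ − eⱼ) : i < j}`, the counting function
`E(k) = |Γ ∩ kP|` satisfies `(1−z)^{n+1} ∑_k E(k) z^k = ∑_{j=0}^n binom(n,j)² z^j`
as formal power series. -/
theorem root_lattice_An_ehrhart_series (n : ℕ) (hn : 1 ≤ n) :
    PowerSeries.mk (fun k : ℕ =>
        ({x : Fin (n + 1) → ℤ | (∑ i, x i) = 0 ∧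
            (fun i => (x i : ℝ)) ∈ (k : ℝ) •
              convexHull ℝ {v : Fin (n + 1) → ℝ | ∃ i j : Fin (n + 1), i < j ∧
                (v = Pi.single i (1 : ℝ) - Pi.single j (1 : ℝ) ∨
                 v = Pi.single j (1 : ℝ) - Pi.single i (1 : ℝ))}}.ncard : ℤ)) *
      (1 - PowerSeries.X) ^ (n + 1)
    = ∑ j ∈ Finset.range (n + 1), PowerSeries.C (R := ℤ) ((n.choose j : ℤ) ^ 2) * PowerSeries.X ^ j := by
  have hE : PowerSeries.mk (fun k : ℕ =>
        ({x : Fin (n + 1) → ℤ | (∑ i, x i) = 0 ∧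
            (fun i => (x i : ℝ)) ∈ (k : ℝ) • convexHull ℝ (anRoots n)}.ncard : ℤ)) =
      PowerSeries.mk (fun m => ((anT n m).card : ℤ)) * PowerSeries.mk 1 := by
    ext k
    rw [PowerSeries.coeff_mk, an_ncard hn, PowerSeries.coeff_mul,
      Finset.Nat.sum_antidiagonal_eq_sum_range_succ_mk]
    simp
  have hS : PowerSeries.mk (fun m => ((anT n m).card : ℤ)) *
      PowerSeries.mk (fun k => ((n + k).choose n : ℤ)) =
      PowerSeries.mk (fun k => ((n + k).choose n : ℤ) * ((n + k).choose n : ℤ)) := by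
    ext k
    rw [PowerSeries.coeff_mk, PowerSeries.coeff_mul, ← sq]
    have := an_pairs n k
    zify at this
    rw [this]
    simp
  have hL := an_li n n
  have h1 := PowerSeries.mk_one_mul_one_sub_eq_one ℤ
  have hC := PowerSeries.mk_add_choose_mul_one_sub_pow_eq_one ℤ n
  have hR : ∑ j ∈ Finset.range (n + 1), PowerSeries.C (R := ℤ) ((n.choose j : ℤ) ^ 2) * PowerSeries.X ^ j
      = PowerSeries.mk (fun j : ℕ => (n.choose j : ℤ) * (n.choose j : ℤ)) := by
    ext k
    simp only [map_sum, PowerSeries.coeff_C_mul, PowerSeries.coeff_X_pow, PowerSeries.coeff_mk,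
      mul_ite, mul_one, mul_zero, Finset.sum_ite_eq, Finset.mem_range]
    split_ifs with h
    · ring
    · rw [Nat.choose_eq_zero_of_lt (by omega)]; simp
  rw [hR]
  change PowerSeries.mk (fun k : ℕ =>
        ({x : Fin (n + 1) → ℤ | (∑ i, x i) = 0 ∧
            (fun i => (x i : ℝ)) ∈ (k : ℝ) • convexHull ℝ (anRoots n)}.ncard : ℤ)) *
      (1 - PowerSeries.X) ^ (n + 1) = _
  rw [hE, ← hL, ← hS]
  set S := PowerSeries.mk (fun m => ((anT n m).card : ℤ))
  calc S * PowerSeries.mk 1 * (1 - PowerSeries.X) ^ (n + 1)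
      = S * (PowerSeries.mk 1 * (1 - PowerSeries.X)) * (1 - PowerSeries.X) ^ n := by ring
    _ = S * (1 - PowerSeries.X) ^ n := by rw [h1, mul_one]
    _ = S * (PowerSeries.mk (fun k => ((n + k).choose n : ℤ)) * (1 - PowerSeries.X) ^ (n + 1)) *
          (1 - PowerSeries.X) ^ n := by rw [hC, mul_one]
    _ = _ := by ring
end
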